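/- arXiv:1211.1477 — 2 statements merged into one kernel-verified Lean document; each statement's English description precedes it below -/
import Mathlib

section
/- Let (R,m) be a Noetherian local ring, I an ideal, and N a finitely generated R-module. Let k ≥ -1 and 0 ≤ i ≤ k+1 be integers. Then depth_k(I,N) = inf { depth_{k-i}(I_p, N_p) : p ∈ Supp_R(N/IN), dim(R/p) ≥ i }, with the convention inf(∅) = ∞. -/
open CategoryTheory Opposite IsLocalRing

/-- Interpretation of an integer `k ≥ -1` in `WithBot ℕ∞`, for comparison with Krull dimensions. -/
noncomputable def zdim (k : ℤ) : WithBot (WithTop ℕ) :=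
  if k < 0 then ⊥ else ((k.toNat : WithTop ℕ) : WithBot (WithTop ℕ))

/-- The ideal generated by the first `j` entries of the sequence `x`. -/
def prefIdeal {R : Type} [CommRing R] {r : ℕ} (x : Fin r → R) (j : ℕ) : Ideal R :=
  Ideal.span (x '' {i | (i : ℕ) < j})

/-- `x` is an `N`-sequence in dimension `> k`: for each `i`, `x i` avoids every associated
prime `p` of `N/(x_0,…,x_{i-1})N` with `dim(R/p) > k`. -/
def IsSeqInDimGT (R : Type) [CommRing R] (N : Type) [AddCommGroup N] [Module R N]
    (k : ℤ) {r : ℕ} (x : Fin r → R) : Prop :=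
  ∀ i : Fin r, ∀ p ∈ associatedPrimes R (N ⧸ (prefIdeal x (i : ℕ) • ⊤ : Submodule R N)),
    zdim k < ringKrullDim (R ⧸ p) → x i ∉ p

/-- `depth_k(I,N)`: the common length of maximal `N`-sequences in dimension `> k`
contained in `I` (realized as the supremum of lengths of such sequences). -/
noncomputable def depthK (R : Type) [CommRing R] (k : ℤ) (I : Ideal R)
    (N : Type) [AddCommGroup N] [Module R N] : ℕ∞ :=
  sSup {n : ℕ∞ | ∃ (r : ℕ) (x : Fin r → R),
    (∀ i, x i ∈ I) ∧ IsSeqInDimGT R N k x ∧ n = (r : ℕ∞)}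

/-- The set of prime (or arbitrary) ideals `p` with `dim(R/p) ≥ k`. -/
def dimGE (R : Type) [CommRing R] (k : ℤ) : Set (Ideal R) :=
  {p | zdim k ≤ ringKrullDim (R ⧸ p)}

theorem zdim_lt_iff {k : ℤ} (hk : -1 ≤ k) {d : WithBot ℕ∞} :
    zdim k < d ↔ (((k + 1).toNat : ℕ) : WithBot ℕ∞) ≤ d := by
  obtain ⟨n, rfl⟩ : ∃ n : ℕ, k = (n : ℤ) - 1 := ⟨(k + 1).toNat, by omega⟩
  cases n with
  | zero =>
    simp only [zdim, CharP.cast_eq_zero, zero_sub, Int.reduceNeg, Int.reduceLT, if_true,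
      neg_add_cancel, Int.toNat_zero]
    induction d with
    | bot => exact iff_of_false (lt_irrefl _) (WithBot.not_coe_le_bot 0)
    | coe d => exact iff_of_true (WithBot.bot_lt_coe d) (WithBot.coe_le_coe.2 zero_le)
  | succ n =>
    rw [zdim, if_neg (by omega)]
    simp only [Nat.cast_add, Nat.cast_one, add_sub_cancel_right, Int.toNat_natCast]
    rw [show ((n : ℤ) + 1).toNat = n + 1 by omega]
    induction d with
    | bot => exact iff_of_false not_lt_bot (WithBot.not_coe_le_bot ((n + 1 : ℕ) : ℕ∞))
    | coe d =>
      refine WithBot.coe_lt_coe.trans (Iff.trans ?_ WithBot.coe_le_coe.symm)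
      exact (ENat.add_one_le_iff (ENat.natCast_ne_top n)).symm

theorem zdim_le_iff {k : ℤ} (hk : 0 ≤ k) {d : WithBot ℕ∞} :
    zdim k ≤ d ↔ ((k.toNat : ℕ) : WithBot ℕ∞) ≤ d := by
  rw [zdim, if_neg (by omega)]
  rfl

theorem le_ringKrullDim_quotient_iff {R : Type*} [CommRing R] {I : Ideal R} {n : ℕ} :
    (n : WithBot ℕ∞) ≤ ringKrullDim (R ⧸ I) ↔
      ∃ l : LTSeries (PrimeSpectrum R), l.length = n ∧ I ≤ l.head.asIdeal := by
  rw [ringKrullDim_quotient, Order.le_krullDim_iff]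
  constructor
  · rintro ⟨l, hl⟩
    exact ⟨l.map _ (Subtype.strictMono_coe _), hl, l.head.2⟩
  · rintro ⟨l, hl, hI⟩
    exact ⟨⟨l.length, fun j ↦ ⟨l j, hI.trans (l.monotone (Fin.zero_le j) : l.head ≤ l j)⟩,
      fun j ↦ l.step j⟩, hl⟩

section Localization

variable {R : Type} [CommRing R] (p : PrimeSpectrum R)

local notation "Rₚ" => Localization.AtPrime (PrimeSpectrum.asIdeal p)

theorem add_le_ringKrullDim_quotient_comap {P : PrimeSpectrum Rₚ} {m n : ℕ}
    (hP : (n : WithBot ℕ∞) ≤ ringKrullDim (Rₚ ⧸ P.asIdeal))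
    (hp : (m : WithBot ℕ∞) ≤ ringKrullDim (R ⧸ p.asIdeal)) :
    ((n + m : ℕ) : WithBot ℕ∞) ≤
      ringKrullDim (R ⧸ P.asIdeal.comap (algebraMap R Rₚ)) := by
  rw [le_ringKrullDim_quotient_iff] at *
  obtain ⟨l, rfl, hl⟩ := hP
  obtain ⟨l', rfl, hl'⟩ := hp
  let e := IsLocalization.AtPrime.primeSpectrumOrderIso Rₚ p.asIdeal
  let l₁ := (l.map e e.strictMono).map _ (Subtype.strictMono_coe _)
  have hlast : l₁.last ≤ p := (e l.last).2
  have hhead : P.asIdeal.comap (algebraMap R Rₚ) ≤ l₁.head.asIdeal := Ideal.comap_mono hl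
  obtain heq | hlt := (hlast.trans hl').eq_or_lt
  · exact ⟨l₁.smash l' heq, rfl, hhead.trans (RelSeries.head_smash heq).ge⟩
  · refine ⟨(l₁.append l' hlt).eraseLast, rfl, hhead.trans ?_⟩
    rw [RelSeries.head_eraseLast, RelSeries.head_append]

theorem le_ringKrullDim_quotient_of_comap_le {P : PrimeSpectrum Rₚ}
    {l : LTSeries (PrimeSpectrum R)}
    (hl : l.last = p) (hP : P.asIdeal.comap (algebraMap R Rₚ) ≤ l.head.asIdeal) :
    (l.length : WithBot ℕ∞) ≤ ringKrullDim (Rₚ ⧸ P.asIdeal) := by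
  rw [le_ringKrullDim_quotient_iff]
  let e := IsLocalization.AtPrime.primeSpectrumOrderIso Rₚ p.asIdeal
  let l₁ : LTSeries (Set.Iic p) :=
    ⟨l.length, fun j ↦ ⟨l j, (l.monotone (Fin.le_last j)).trans hl.le⟩,
      fun j ↦ l.step j⟩
  refine ⟨l₁.map e.symm e.symm.strictMono, rfl, ?_⟩
  have : e P ≤ l₁.head := hP
  exact (e.le_symm_apply).2 this

theorem prefIdeal_map {r : ℕ} (x : Fin r → R) (j : ℕ) :
    prefIdeal (fun i ↦ algebraMap R Rₚ (x i)) j = (prefIdeal x j).map (algebraMap R Rₚ) := by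
  rw [prefIdeal, prefIdeal, Ideal.map_span, Set.image_image]

theorem mem_associatedPrimes_localization_iff [IsNoetherianRing R] {N : Type} [AddCommGroup N]
    [Module R N] (J : Ideal R) (P : Ideal Rₚ) :
    P ∈ associatedPrimes Rₚ (LocalizedModule p.asIdeal.primeCompl N ⧸
        (J.map (algebraMap R Rₚ) • ⊤ : Submodule Rₚ (LocalizedModule p.asIdeal.primeCompl N))) ↔
      P.comap (algebraMap R Rₚ) ∈ associatedPrimes R (N ⧸ (J • ⊤ : Submodule R N)) := by
  have h : (J • ⊤ : Submodule R N).localized p.asIdeal.primeCompl =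
      J.map (algebraMap R Rₚ) • ⊤ := by
    rw [Submodule.localized, Submodule.localized'_smul, Ideal.localized'_eq_map,
      Submodule.localized'_top]
  rw [← h,
    ← Module.associatedPrimes.preimage_comap_associatedPrimes_eq_associatedPrimes_of_isLocalizedModule
    p.asIdeal.primeCompl Rₚ ((J • ⊤ : Submodule R N).toLocalizedQuotient p.asIdeal.primeCompl)]
  rfl

theorem IsSeqInDimGT.localization [IsNoetherianRing R] {N : Type} [AddCommGroup N]
    [Module R N] {k k' : ℤ} {r : ℕ} {x : Fin r → R} (hx : IsSeqInDimGT R N k x)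
    (h : ∀ P : PrimeSpectrum Rₚ, zdim k' < ringKrullDim (Rₚ ⧸ P.asIdeal) →
      zdim k < ringKrullDim (R ⧸ P.asIdeal.comap (algebraMap R Rₚ))) :
    IsSeqInDimGT Rₚ (LocalizedModule p.asIdeal.primeCompl N) k'
      (fun i ↦ algebraMap R Rₚ (x i)) := by
  intro i P hP hd
  have hprime : P.IsPrime := hP.isPrime
  rw [prefIdeal_map, mem_associatedPrimes_localization_iff] at hP
  exact hx i _ hP (h ⟨P, hprime⟩ hd)

end Localization

section Local

open RingTheory.Sequence

theorem ofList_eq_prefIdeal {R : Type} [CommRing R] {r : ℕ} (x : Fin r → R) (j : ℕ) :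
    Ideal.ofList ((List.ofFn x).take j) = prefIdeal x j := by
  rw [Ideal.ofList, prefIdeal]
  congr 1
  ext a
  simp only [List.mem_take_iff_getElem, Set.mem_image]
  constructor
  · rintro ⟨i, hi, rfl⟩
    simp only [List.length_ofFn, lt_min_iff] at hi
    exact ⟨⟨i, hi.2⟩, hi.1, by simp⟩
  · rintro ⟨i, hi, rfl⟩
    exact ⟨i, by simpa using hi, by simp⟩

theorem IsSeqInDimGT.isWeaklyRegular {R : Type} [CommRing R] [IsNoetherianRing R]
    {N : Type} [AddCommGroup N] [Module R N]
    {r : ℕ} {x : Fin r → R} (hx : IsSeqInDimGT R N (-1) x) :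
    IsWeaklyRegular N (List.ofFn x) := by
  rw [isWeaklyRegular_iff_Fin]
  intro i
  rw [ofList_eq_prefIdeal]
  by_contra h
  rw [← Set.mem_ofPred (p := fun r ↦ IsSMulRegular _ r), ← Set.mem_compl_iff,
    ← biUnion_associatedPrimes_eq_compl_regular] at h
  simp only [Set.mem_iUnion] at h
  obtain ⟨p, hp, h⟩ := h
  refine hx ⟨i, by simpa using i.2⟩ p hp ?_ (by simpa using h)
  have := hp.isPrime
  have := ringKrullDim_nonneg_of_nontrivial (R := R ⧸ p)
  exact lt_of_lt_of_le (by simp [zdim]; exact WithBot.bot_lt_coe _) this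

open CategoryTheory Abelian in
theorem IsRegular.exists_isSMulRegular_of_length_lt {R : Type} [CommRing R] [IsNoetherianRing R]
    (I : Ideal R) (rs ss : List R) (N : Type) [AddCommGroup N] [Module R N] [Module.Finite R N]
    (hN : I • (⊤ : Submodule R N) < ⊤) (hr : ∀ r ∈ rs, r ∈ I) (hs : ∀ s ∈ ss, s ∈ I)
    (hrs : IsRegular N rs) (hss : IsRegular N ss) (h : rs.length < ss.length) :
    ∃ z ∈ I, IsSMulRegular (N ⧸ (Ideal.ofList rs • ⊤ : Submodule R N)) z := by
  induction rs generalizing N ss with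
  | nil =>
    obtain ⟨s, ss, rfl⟩ := List.exists_cons_of_length_pos h
    refine ⟨s, hs s (by simp), ?_⟩
    rw [(Submodule.quotEquivOfEqBot _ (by simp)).isSMulRegular_congr]
    exact ((isRegular_cons_iff N s ss).1 hss).1
  | cons r rs ih =>
    obtain ⟨hr0, hr⟩ := List.forall_mem_cons.1 hr
    obtain ⟨hreg, hrs⟩ := (isRegular_cons_iff N r rs).1 hrs
    have hN' : I • (⊤ : Submodule R (QuotSMulTop r N)) < ⊤ := by
      refine lt_top_iff_ne_top.2 fun heq ↦ hN.ne ?_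
      have := congrArg (Submodule.comap (Submodule.mkQ _)) heq
      simpa [Submodule.comap_smul_top_of_surjective I _ (Submodule.mkQ_surjective _),
        Submodule.smul_mono_left ((Ideal.span_singleton_le_iff_mem I).mpr hr0),
        ← Submodule.ideal_span_singleton_smul] using this
    have hiff := (ModuleCat.exists_isRegular_tfae I ss.length (ModuleCat.of R N) hN).out 3 1
    have hext := hiff.1 ⟨ss, rfl, hs, hss⟩
    have hiff' := (ModuleCat.exists_isRegular_tfae I (ss.length - 1)
      (ModuleCat.of R (QuotSMulTop r N)) hN').out 1 3
    obtain ⟨ss', hlen, hs', hss'⟩ :=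
      hiff'.1 (fun i hi ↦
      AddCommGrpCat.subsingleton_of_isZero <| ShortComplex.Exact.isZero_of_both_zeros
        ((Ext.covariant_sequence_exact₃' _
          (IsSMulRegular.smulShortComplex_shortExact (M := ModuleCat.of R N) hreg)) i (i + 1) rfl)
        ((AddCommGrpCat.isZero_of_iff_subsingleton.mpr (hext i (by omega))).eq_zero_of_src _)
        ((AddCommGrpCat.isZero_of_iff_subsingleton.mpr (hext (i + 1) (by omega))).eq_zero_of_tgt _))
    obtain ⟨z, hz, hzreg⟩ := ih ss' (QuotSMulTop r N) hN' hr hs' hrs hss'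
      (by rw [List.length_cons] at h; omega)
    exact ⟨z, hz, ((Submodule.quotOfListConsSMulTopEquivQuotSMulTopInner N r rs).isSMulRegular_congr
      z).2 hzreg⟩

theorem IsWeaklyRegular.length_le_of_maximalIdeal_mem_associatedPrimes {R : Type} [CommRing R]
    [IsNoetherianRing R] [IsLocalRing R]
    {N : Type} [AddCommGroup N] [Module R N] [Module.Finite R N] {rs ss : List R}
    (hr : ∀ r ∈ rs, r ∈ maximalIdeal R) (hs : ∀ r ∈ ss, r ∈ maximalIdeal R)
    (hrs : IsWeaklyRegular N rs) (hss : IsWeaklyRegular N ss)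
    (h : maximalIdeal R ∈ associatedPrimes R (N ⧸ (Ideal.ofList rs • ⊤ : Submodule R N))) :
    ss.length ≤ rs.length := by
  by_contra! hlt
  have : Nontrivial N := by
    by_contra hN
    rw [not_nontrivial_iff_subsingleton] at hN
    exact not_isAssociatedPrime_of_subsingleton h
  have hN : maximalIdeal R • (⊤ : Submodule R N) < ⊤ :=
    (Submodule.top_ne_ideal_smul_of_le_jacobson_annihilator
          (IsLocalRing.maximalIdeal_le_jacobson _)).symm.lt_top
  obtain ⟨z, hz, hreg⟩ := IsRegular.exists_isSMulRegular_of_length_lt (maximalIdeal R) rs ss N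
    hN hr hs
    ((isRegular_iff_isWeaklyRegular_of_subset_maximalIdeal hr).2 hrs)
    ((isRegular_iff_isWeaklyRegular_of_subset_maximalIdeal hs).2 hss) hlt
  have := biUnion_associatedPrimes_eq_compl_regular R (N ⧸ (Ideal.ofList rs • ⊤ : Submodule R N))
  have h2 : z ∈ {r : R | IsSMulRegular (N ⧸ (Ideal.ofList rs • ⊤ : Submodule R N)) r}ᶜ := by
    rw [← this]
    exact Set.mem_biUnion h hz
  exact h2 hreg

end Local

theorem depthK_le_of_mem_associatedPrimes {R : Type} [CommRing R] [IsNoetherianRing R]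
    {N : Type} [AddCommGroup N] [Module R N] [Module.Finite R N] {k : ℤ} {I q : Ideal R} {r : ℕ}
    {x : Fin r → R} (hxI : ∀ i, x i ∈ I) (hx : IsSeqInDimGT R N k x)
    (hq : q ∈ associatedPrimes R (N ⧸ (prefIdeal x r • ⊤ : Submodule R N))) (hIq : I ≤ q)
    (hd : zdim k < ringKrullDim (R ⧸ q)) : depthK R k I N ≤ r := by
  refine sSup_le ?_
  rintro _ ⟨s, y, hyI, hy, rfl⟩
  have hprime : q.IsPrime := hq.isPrime
  let p : PrimeSpectrum R := ⟨q, hprime⟩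
  have hdim (P : PrimeSpectrum (Localization.AtPrime q)) :
      zdim k < ringKrullDim (R ⧸ P.asIdeal.comap (algebraMap R (Localization.AtPrime q))) := by
    have hle : P.asIdeal.comap (algebraMap R (Localization.AtPrime q)) ≤ q :=
      (IsLocalization.AtPrime.primeSpectrumOrderIso (Localization.AtPrime q) q P).2
    exact hd.trans_le (ringKrullDim_le_of_surjective _ (Ideal.Quotient.factor_surjective hle))
  have hloc {t : ℕ} {z : Fin t → R} (hz : ∀ i, z i ∈ I) (a : Localization.AtPrime q)
      (ha : a ∈ List.ofFn fun i ↦ algebraMap R (Localization.AtPrime q) (z i)) :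
      a ∈ maximalIdeal (Localization.AtPrime q) := by
    obtain ⟨i, rfl⟩ := List.mem_ofFn.1 ha
    exact (IsLocalization.AtPrime.to_map_mem_maximal_iff _ q _).2 (hIq (hz i))
  have hlen := IsWeaklyRegular.length_le_of_maximalIdeal_mem_associatedPrimes
    (hloc hxI) (hloc hyI)
    (hx.localization p fun P _ ↦ hdim P).isWeaklyRegular
    (hy.localization p fun P _ ↦ hdim P).isWeaklyRegular (by
      have := ofList_eq_prefIdeal (fun i ↦ algebraMap R (Localization.AtPrime q) (x i)) r
      rw [List.take_of_length_le (by simp)] at this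
      rw [this, prefIdeal_map p, mem_associatedPrimes_localization_iff p]
      have hmax : (maximalIdeal (Localization.AtPrime q)).comap
          (algebraMap R (Localization.AtPrime q)) = q := Localization.AtPrime.under_maximalIdeal
      change (maximalIdeal (Localization.AtPrime q)).comap
          (algebraMap R (Localization.AtPrime q)) ∈ _
      rwa [hmax])
  simpa using hlen

theorem exists_mem_associatedPrimes_of_depthK_lt_top {R : Type} [CommRing R] [IsNoetherianRing R]
    {N : Type} [AddCommGroup N] [Module R N] [Module.Finite R N] {k : ℤ} {I : Ideal R}
    (h : depthK R k I N < ⊤) :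
    ∃ (r : ℕ) (x : Fin r → R) (q : Ideal R), (∀ i, x i ∈ I) ∧ IsSeqInDimGT R N k x ∧
      depthK R k I N = r ∧ q ∈ associatedPrimes R (N ⧸ (prefIdeal x r • ⊤ : Submodule R N)) ∧
      I ≤ q ∧ zdim k < ringKrullDim (R ⧸ q) := by
  have : Nonempty {n : ℕ∞ | ∃ (r : ℕ) (x : Fin r → R),
      (∀ i, x i ∈ I) ∧ IsSeqInDimGT R N k x ∧ n = (r : ℕ∞)} :=
    ⟨0, 0, Fin.elim0, fun i ↦ i.elim0, fun i ↦ i.elim0, rfl⟩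
  obtain ⟨r, x, hxI, hx, hr⟩ := ENat.sSup_mem_of_nonempty_of_lt_top h
  let S := {q ∈ associatedPrimes R (N ⧸ (prefIdeal x r • ⊤ : Submodule R N)) |
    zdim k < ringKrullDim (R ⧸ q)}
  suffices ∃ q ∈ S, I ≤ q by
    obtain ⟨q, hqS, hIq⟩ := this
    exact ⟨r, x, q, hxI, hx, hr, hqS.1, hIq, hqS.2⟩
  refine (Ideal.subset_union_prime_finite ((associatedPrimes.finite R _).subset fun q hq ↦ hq.1)
    (f := id) ⊥ ⊥ fun q hq _ _ ↦ hq.1.isPrime).1 fun y hy ↦ ?_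
  by_contra hyS
  simp only [Set.mem_iUnion, not_exists] at hyS
  have hpref {j : ℕ} (hj : j ≤ r) :
      prefIdeal (Fin.snoc x y : Fin (r + 1) → R) j = prefIdeal x j := by
    rw [prefIdeal, prefIdeal]
    congr 1
    ext a
    constructor
    · rintro ⟨i, hi, rfl⟩
      refine ⟨⟨i, hi.trans_le hj⟩, hi, ?_⟩
      exact (Fin.snoc_castSucc (α := fun _ ↦ R) y x ⟨i, hi.trans_le hj⟩).symm
    · rintro ⟨i, hi, rfl⟩
      exact ⟨i.castSucc, hi, Fin.snoc_castSucc (α := fun _ ↦ R) ..⟩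
  have hle : ((r + 1 : ℕ) : ℕ∞) ≤ depthK R k I N := by
    refine le_sSup ⟨r + 1, Fin.snoc x y, fun i ↦ ?_, fun i q hq hd ↦ ?_, rfl⟩
    · cases i using Fin.lastCases with
      | last => simpa using hy
      | cast i => simpa using hxI i
    · rw [hpref (Nat.le_of_lt_succ i.2)] at hq
      cases i using Fin.lastCases with
      | last => simpa using hyS q ⟨hq, hd⟩
      | cast i => simpa using hx i q hq hd
  rw [depthK, hr, Nat.cast_le] at hle
  omega

/-- Lemma: `depth_k(I,N) = inf { depth_{k-i}(I_p, N_p) : p ∈ Supp(N/IN), dim(R/p) ≥ i }`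
for all `0 ≤ i ≤ k+1` (with `inf ∅ = ∞`). -/
theorem depthK_eq_inf_localized (R : Type) [CommRing R] [IsNoetherianRing R] [IsLocalRing R]
    (I : Ideal R) (N : Type) [AddCommGroup N] [Module R N] [Module.Finite R N]
    (k : ℤ) (hk : -1 ≤ k) (i : ℤ) (hi0 : 0 ≤ i) (hik : i ≤ k + 1) :
    depthK R k I N
      = ⨅ (p : PrimeSpectrum R)
          (_ : p ∈ Module.support R (N ⧸ (I • ⊤ : Submodule R N))
                ∧ zdim i ≤ ringKrullDim (R ⧸ p.asIdeal)),
          depthK (Localization.AtPrime p.asIdeal) (k - i)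
            (Ideal.map (algebraMap R (Localization.AtPrime p.asIdeal)) I)
            (LocalizedModule p.asIdeal.primeCompl N) := by
  have hki : -1 ≤ k - i := by omega
  refine le_antisymm (le_iInf₂ fun p hp ↦ sSup_le ?_) ?_
  · rintro _ ⟨r, x, hxI, hx, rfl⟩
    refine le_sSup ⟨r, _, fun j ↦ Ideal.mem_map_of_mem _ (hxI j), hx.localization p ?_, rfl⟩
    intro P hP
    rw [zdim_lt_iff hki] at hP
    rw [zdim_lt_iff hk]
    convert add_le_ringKrullDim_quotient_comap p hP ((zdim_le_iff hi0).1 hp.2) using 3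
    omega
  obtain htop | hlt := eq_top_or_lt_top (depthK R k I N)
  · exact htop ▸ le_top
  obtain ⟨r, x, q, hxI, hx, hr, hq, hIq, hd⟩ := exists_mem_associatedPrimes_of_depthK_lt_top hlt
  have hprime : q.IsPrime := hq.isPrime
  obtain ⟨l, hl, hql⟩ := le_ringKrullDim_quotient_iff.1 ((zdim_lt_iff hk).1 hd)
  let j : Fin (l.length + 1) := ⟨(k - i + 1).toNat, by omega⟩
  let p := l j
  have hqp : q ≤ p.asIdeal := hql.trans (l.monotone (Fin.zero_le j) : l.head ≤ l j)
  have hpd : zdim i ≤ ringKrullDim (R ⧸ p.asIdeal) := by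
    rw [zdim_le_iff hi0, le_ringKrullDim_quotient_iff]
    refine ⟨l.drop j, ?_, (RelSeries.head_drop l j).ge⟩
    simp only [RelSeries.drop, j]
    omega
  have hsupp : p ∈ Module.support R (N ⧸ (I • ⊤ : Submodule R N)) := by
    rw [Module.support_quotient, Module.support_eq_zeroLocus]
    refine ⟨?_, hIq.trans hqp⟩
    refine le_trans (fun a ha ↦ ?_) (hq.annihilator_le.trans hqp)
    rw [Submodule.annihilator_top]
    exact (LinearMap.annihilator_le_of_surjective _ (Submodule.mkQ_surjective _)) ha
  refine (iInf₂_le p ⟨hsupp, hpd⟩).trans ?_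
  let P : PrimeSpectrum (Localization.AtPrime p.asIdeal) :=
    (IsLocalization.AtPrime.primeSpectrumOrderIso (Localization.AtPrime p.asIdeal)
      p.asIdeal).symm ⟨⟨q, hprime⟩, hqp⟩
  have hP : P.asIdeal.comap (algebraMap R (Localization.AtPrime p.asIdeal)) = q := by
    have := (IsLocalization.AtPrime.primeSpectrumOrderIso (Localization.AtPrime p.asIdeal)
      p.asIdeal).apply_symm_apply
      ⟨⟨q, hprime⟩, hqp⟩
    exact congrArg (fun z ↦ z.1.asIdeal) this
  rw [hr]
  refine depthK_le_of_mem_associatedPrimes (q := P.asIdeal)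
    (fun j ↦ Ideal.mem_map_of_mem _ (hxI j)) (hx.localization p ?_) ?_ ?_ ?_
  · intro P hP
    rw [zdim_lt_iff hki] at hP
    rw [zdim_lt_iff hk]
    convert add_le_ringKrullDim_quotient_comap p hP ((zdim_le_iff hi0).1 hpd) using 3
    omega
  · rwa [prefIdeal_map, mem_associatedPrimes_localization_iff, hP]
  · rwa [Ideal.map_le_iff_le_comap, hP]
  · rw [zdim_lt_iff hki]
    have := le_ringKrullDim_quotient_of_comap_le p (P := P) (l := l.take j)
      (RelSeries.last_take l j) (by rw [hP, RelSeries.head_take]; exact hql)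
    exact this
end

section
/- Let R be a Noetherian local ring, 𝔑 = ⊕_{n≥0} N_n a finitely generated graded module over a finitely generated standard graded R-algebra 𝔕 = ⊕_{n≥0} R_n with R_0 = R. Let I be an ideal of R, k ≥ -1 an integer, and r ≥ 1 the eventual (constant for large n) value of depth_k(I, N_n). Then there exists a sequence x_1,...,x_r of elements of I which is an N_n-sequence in dimension > k simultaneously for all sufficiently large n. -/
open CategoryTheory Opposite IsLocalRing

section Ext

open RingTheory.Sequence CategoryTheory.Abelian

variable {R : Type} [CommRing R]

/-- If `rs` is weakly regular on `M` and annihilates `N`, then `Ext N M i` vanishes for every `i`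
below the length of `rs`. -/
theorem subsingleton_ext_of_isWeaklyRegular (N M : ModuleCat.{0} R) (rs : List R)
    (mem : ∀ a ∈ rs, a ∈ Module.annihilator R N) (reg : IsWeaklyRegular M rs) :
    ∀ i < rs.length, Subsingleton (Ext N M i) := by
  induction rs generalizing M with
  | nil => simp
  | cons a rs ih =>
    intro i hi
    simp only [isWeaklyRegular_cons_iff] at reg
    simp only [List.mem_cons, forall_eq_or_imp] at mem
    match i with
    | 0 =>
      have : Subsingleton (N →ₗ[R] M) := by
        refine ⟨fun f g ↦ LinearMap.ext fun v ↦ reg.1 ?_⟩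
        simp only [← map_smul, Module.mem_annihilator.mp mem.1 v, map_zero]
      exact (Ext.addEquiv₀.trans ModuleCat.homAddEquiv).subsingleton
    | i + 1 =>
      let g := (AddCommGrpCat.ofHom ((Ext.mk₀ (ModuleCat.smulShortComplex M a).f).postcomp N
        (add_zero (i + 1))))
      have mono_g : Mono g := by
        apply (Ext.covariant_sequence_exact₁' N reg.1.smulShortComplex_shortExact i (i + 1)
          rfl).mono_g ((AddCommGrpCat.isZero_of_iff_subsingleton.mpr ?_).eq_zero_of_src _)
        exact ih (ModuleCat.of R (QuotSMulTop a M)) mem.2 reg.2 i (by simpa using hi)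
      have zero_g : g = 0 := Ext.postcomp_smul_id_eq_zero_of_mem_annihilator mem.1 (i + 1)
      exact AddCommGrpCat.subsingleton_of_isZero (Limits.IsZero.of_mono_eq_zero _ zero_g)

/-- If `rs` is weakly regular on `M` and `Ext N M i` vanishes for every `i` up to the length of
`rs`, then there is no nonzero linear map from `N` to `M / rs M`. -/
theorem subsingleton_linearMap_of_subsingleton_ext (N M : ModuleCat.{0} R) (rs : List R)
    (reg : IsWeaklyRegular M rs) (hext : ∀ i ≤ rs.length, Subsingleton (Ext N M i)) :
    Subsingleton (N →ₗ[R] (M ⧸ (Ideal.ofList rs • ⊤ : Submodule R M))) := by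
  induction rs generalizing M with
  | nil =>
    have : Subsingleton (N →ₗ[R] M) :=
      (Ext.addEquiv₀.trans ModuleCat.homAddEquiv).symm.subsingleton_congr.mpr
        (hext 0 le_rfl)
    have h : (Ideal.ofList ([] : List R) • ⊤ : Submodule R M) = ⊥ := by simp
    exact (((Submodule.quotEquivOfEqBot _ h).congrRight (M := N)).toEquiv).subsingleton
  | cons a rs ih =>
    simp only [isWeaklyRegular_cons_iff] at reg
    have := ih (ModuleCat.of R (QuotSMulTop a M)) reg.2 fun i hi ↦ by
      have zero1 := AddCommGrpCat.isZero_of_iff_subsingleton.mpr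
        (hext i (hi.trans (by simp)))
      have zero2 := AddCommGrpCat.isZero_of_iff_subsingleton.mpr
        (hext (i + 1) (by simpa using hi))
      exact AddCommGrpCat.subsingleton_of_isZero <| ShortComplex.Exact.isZero_of_both_zeros
        ((Ext.covariant_sequence_exact₃' N reg.1.smulShortComplex_shortExact) i (i + 1) rfl)
        (zero1.eq_zero_of_src _) (zero2.eq_zero_of_tgt _)
    exact (((Submodule.quotOfListConsSMulTopEquivQuotSMulTopInner M a rs).congrRight
      (M := N)).toEquiv).subsingleton

end Ext

section AssociatedPrimes

/-- Over a noetherian ring, the associated primes of `M / K` are the prime ideals of the form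
`K : u` with `u ∈ M`. -/
theorem mem_associatedPrimes_quotient_iff {R M : Type*} [CommRing R] [IsNoetherianRing R]
    [AddCommGroup M] [Module R M] {K : Submodule R M} {p : Ideal R} :
    p ∈ associatedPrimes R (M ⧸ K) ↔ p.IsPrime ∧ ∃ u : M, p = K.colon {u} := by
  rw [AssociatedPrimes.mem_iff, isAssociatedPrime_iff, (Submodule.mkQ_surjective K).exists]
  refine and_congr_right fun _ ↦ exists_congr fun u ↦ ?_
  suffices (⊥ : Submodule R (M ⧸ K)).colon {K.mkQ u} = K.colon {u} by rw [this]
  ext a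
  rw [Submodule.mem_colon_singleton, Submodule.mem_colon_singleton, Submodule.mem_bot, ← map_smul,
    ← LinearMap.mem_ker, Submodule.ker_mkQ]

/-- The annihilator of an element of `M / K` that survives in the localization at `p` is contained
in an associated prime of `M / K` contained in `p`. -/
theorem exists_mem_associatedPrimes_le {R M : Type*} [CommRing R] [IsNoetherianRing R]
    [AddCommGroup M] [Module R M] {K : Submodule R M} {p : Ideal R} [p.IsPrime] {u : M}
    (hu : ∀ s ∉ p, s • u ∉ K) :
    ∃ q ∈ associatedPrimes R (M ⧸ K), K.colon {u} ≤ q ∧ q ≤ p := by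
  have hle : K.colon {u} ≤ p := fun a ha ↦ by
    by_contra hap
    exact hu a hap (Submodule.mem_colon_singleton.mp ha)
  obtain ⟨q, hq, hqp⟩ := Ideal.exists_minimalPrimes_le hle
  exact ⟨q, mem_associatedPrimes_quotient_iff.mpr
    ⟨hq.isPrime, Submodule.exists_eq_colon_of_mem_minimalPrimes hq⟩, hq.1.2, hqp⟩

/-- A finitely generated module over a noetherian `R`-algebra has only finitely many associated
primes over `R`, and so do its quotients by `J M` for ideals `J` of `R`. -/
theorem finite_associatedPrimes_quotient_smul_top {R S M : Type*} [CommRing R] [IsNoetherianRing R]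
    [CommRing S] [Algebra R S] [IsNoetherianRing S] [AddCommGroup M] [Module R M] [Module S M]
    [IsScalarTower R S M] [Module.Finite S M] (J : Ideal R) :
    (associatedPrimes R (M ⧸ (J • ⊤ : Submodule R M))).Finite := by
  let K : Submodule S M := J.map (algebraMap R S) • ⊤
  have hK : K.restrictScalars R = J • ⊤ := by
    rw [Ideal.smul_restrictScalars, Submodule.restrictScalars_top]
  refine ((associatedPrimes.finite S (M ⧸ K)).image (Ideal.comap (algebraMap R S))).subset ?_
  intro p hp
  obtain ⟨hp, u, hu⟩ := mem_associatedPrimes_quotient_iff.mp hp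
  have hcomap : (K.colon {u}).comap (algebraMap R S) = p := by
    ext a
    rw [hu, Ideal.mem_comap, Submodule.mem_colon_singleton, Submodule.mem_colon_singleton,
      algebraMap_smul, ← hK, Submodule.restrictScalars_mem]
  have hmin : p ∈ ((K.colon {u}).comap (algebraMap R S)).minimalPrimes := by
    rw [hcomap, Ideal.minimalPrimes_eq_subsingleton_self]
    rfl
  obtain ⟨P, hP, hPp⟩ := Ideal.exists_minimalPrimes_comap_eq _ p hmin
  exact ⟨P, mem_associatedPrimes_quotient_iff.mpr
    ⟨hP.isPrime, Submodule.exists_eq_colon_of_mem_minimalPrimes hP⟩, hPp⟩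

/-- An associated prime of `L / J L` is an associated prime of `M / J M` if `L` is a direct summand
of `M`. -/
theorem associatedPrimes_quotient_smul_top_subset {R L M : Type*} [CommRing R] [IsNoetherianRing R]
    [AddCommGroup L] [Module R L] [AddCommGroup M] [Module R M] (f : L →ₗ[R] M) (g : M →ₗ[R] L)
    (hgf : ∀ v, g (f v) = v) (J : Ideal R) :
    associatedPrimes R (L ⧸ (J • ⊤ : Submodule R L)) ⊆
      associatedPrimes R (M ⧸ (J • ⊤ : Submodule R M)) := by
  intro p hp
  obtain ⟨hp, u, rfl⟩ := mem_associatedPrimes_quotient_iff.mp hp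
  refine mem_associatedPrimes_quotient_iff.mpr ⟨hp, f u, ?_⟩
  ext a
  rw [Submodule.mem_colon_singleton, Submodule.mem_colon_singleton, ← map_smul]
  refine ⟨fun h ↦ Submodule.smul_top_le_comap_smul_top J f h, fun h ↦ ?_⟩
  simpa [hgf] using Submodule.smul_top_le_comap_smul_top J g h

end AssociatedPrimes

section Localization

variable {R N : Type*} [CommRing R] [AddCommGroup N] [Module R N] (p : Ideal R) [p.IsPrime]

/-- An element of `J N_p` becomes the image of an element of `J N` after multiplication by an
element outside `p`. -/
theorem exists_smul_eq_mkLinearMap_of_mem_smul_top (J : Ideal R)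
    {w : LocalizedModule p.primeCompl N}
    (hw : w ∈ (J • ⊤ : Submodule R (LocalizedModule p.primeCompl N))) :
    ∃ t ∉ p, ∃ v ∈ (J • ⊤ : Submodule R N),
      t • w = LocalizedModule.mkLinearMap p.primeCompl N v := by
  induction hw using Submodule.smul_induction_on' with
  | smul a ha w _ =>
    obtain ⟨⟨v, s⟩, hs⟩ := IsLocalizedModule.surj p.primeCompl
      (LocalizedModule.mkLinearMap p.primeCompl N) w
    refine ⟨s, s.2, a • v, Submodule.smul_mem_smul ha trivial, ?_⟩
    rw [smul_comm, map_smul, ← hs]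
    rfl
  | add w _ w' _ h h' =>
    obtain ⟨t, ht, v, hv, e⟩ := h
    obtain ⟨t', ht', v', hv', e'⟩ := h'
    refine ⟨t * t', fun h ↦ (‹p.IsPrime›.mem_or_mem h).elim ht ht', t' • v + t • v',
      add_mem (Submodule.smul_mem _ _ hv) (Submodule.smul_mem _ _ hv'), ?_⟩
    rw [map_add, map_smul, map_smul, ← e, ← e', smul_add, smul_smul, smul_smul, mul_comm t]

theorem mem_smul_top_of_smul_mem_smul_top (J : Ideal R) {t : R} (ht : t ∉ p)
    {w : LocalizedModule p.primeCompl N}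
    (h : t • w ∈ (J • ⊤ : Submodule R (LocalizedModule p.primeCompl N))) :
    w ∈ (J • ⊤ : Submodule R (LocalizedModule p.primeCompl N)) := by
  obtain ⟨e, he⟩ := (IsLocalizedModule.map_units (S := p.primeCompl)
    (LocalizedModule.mkLinearMap p.primeCompl N) ⟨t, ht⟩).exists_left_inv
  have hw : e (t • w) = w := LinearMap.congr_fun he w
  rw [← hw]
  exact Submodule.smul_top_le_comap_smul_top J e h

theorem mkLinearMap_mem_smul_top_iff (J : Ideal R) (v : N) :
    LocalizedModule.mkLinearMap p.primeCompl N v ∈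
        (J • ⊤ : Submodule R (LocalizedModule p.primeCompl N)) ↔
      ∃ t ∉ p, t • v ∈ (J • ⊤ : Submodule R N) := by
  constructor
  · intro h
    obtain ⟨t, ht, v', hv', e⟩ := exists_smul_eq_mkLinearMap_of_mem_smul_top p J h
    rw [← map_smul] at e
    obtain ⟨c, hc⟩ := IsLocalizedModule.exists_of_eq (S := p.primeCompl) e
    refine ⟨c * t, fun h ↦ (‹p.IsPrime›.mem_or_mem h).elim c.2 ht, ?_⟩
    rw [mul_smul]
    exact (show (c : R) • t • v = (c : R) • v' from hc) ▸ Submodule.smul_mem _ _ hv'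
  · rintro ⟨t, ht, h⟩
    refine mem_smul_top_of_smul_mem_smul_top p J ht ?_
    rw [← map_smul]
    exact Submodule.smul_top_le_comap_smul_top J (LocalizedModule.mkLinearMap p.primeCompl N) h

variable {p} in
/-- An element avoiding the associated primes of `N / J N` contained in `p` is regular on
`N_p / J N_p`. -/
theorem isSMulRegular_localizedModule_quotient [IsNoetherianRing R] {J : Ideal R} {a : R}
    (ha : ∀ q ∈ associatedPrimes R (N ⧸ (J • ⊤ : Submodule R N)), q ≤ p → a ∉ q) :
    IsSMulRegular (LocalizedModule p.primeCompl N ⧸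
      (J • ⊤ : Submodule R (LocalizedModule p.primeCompl N))) a := by
  rw [isSMulRegular_quotient_iff_mem_of_smul_mem]
  intro w hw
  obtain ⟨⟨v, s⟩, hs⟩ := IsLocalizedModule.surj p.primeCompl
    (LocalizedModule.mkLinearMap p.primeCompl N) w
  refine mem_smul_top_of_smul_mem_smul_top p J s.2 ?_
  rw [show (s : R) • w = LocalizedModule.mkLinearMap p.primeCompl N v from hs,
    mkLinearMap_mem_smul_top_iff]
  have hav : LocalizedModule.mkLinearMap p.primeCompl N (a • v) ∈
      (J • ⊤ : Submodule R (LocalizedModule p.primeCompl N)) := by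
    rw [map_smul, ← show (s : R) • w = LocalizedModule.mkLinearMap p.primeCompl N v from hs,
      smul_comm]
    exact Submodule.smul_mem _ _ hw
  obtain ⟨t, ht, htav⟩ := (mkLinearMap_mem_smul_top_iff p J _).mp hav
  by_contra! hv
  obtain ⟨q, hq, hle, hqp⟩ := exists_mem_associatedPrimes_le (p := p) (u := t • v) fun c hc ↦ by
    rw [smul_smul]
    exact hv _ fun h ↦ (‹p.IsPrime›.mem_or_mem h).elim hc ht
  refine ha q hq hqp (hle (Submodule.mem_colon_singleton.mpr ?_))
  rwa [smul_comm]

end Localization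

section DimensionSequence

open RingTheory.Sequence

variable {R : Type} [CommRing R]

theorem ofList_take_ofFn {r : ℕ} (x : Fin r → R) (j : ℕ) :
    Ideal.ofList ((List.ofFn x).take j) = prefIdeal x j := by
  refine congrArg Ideal.span (Set.ext fun a ↦ ?_)
  simp only [List.mem_take_iff_getElem, List.getElem_ofFn, List.length_ofFn, lt_inf_iff,
    Set.mem_ofPred_eq, Set.mem_image]
  exact ⟨fun ⟨i, h, e⟩ ↦ ⟨⟨i, h.2⟩, h.1, e⟩, fun ⟨i, h, e⟩ ↦ ⟨i, ⟨h, i.2⟩, e⟩⟩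

theorem ofList_ofFn {r : ℕ} (x : Fin r → R) : Ideal.ofList (List.ofFn x) = prefIdeal x r := by
  rw [← ofList_take_ofFn, List.take_of_length_le (by simp)]

theorem prefIdeal_snoc {r : ℕ} (x : Fin r → R) (z : R) {j : ℕ} (hj : j ≤ r) :
    prefIdeal (Fin.snoc x z : Fin (r + 1) → R) j = prefIdeal x j := by
  refine congrArg Ideal.span (Set.ext fun a ↦ ⟨?_, ?_⟩)
  · rintro ⟨i, hi, rfl⟩
    have hir : (i : ℕ) < r := lt_of_lt_of_le hi hj
    exact ⟨i.castLT hir, hi, by simp [Fin.snoc, hir]⟩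
  · rintro ⟨i, hi, rfl⟩
    exact ⟨i.castSucc, hi, by simp⟩

variable {N : Type} [AddCommGroup N] [Module R N] {k : ℤ}

/-- An `N`-sequence in dimension `> k` becomes weakly regular after localization at a prime `p`
with `dim (R / p) > k`. -/
theorem IsSeqInDimGT.isWeaklyRegular_localizedModule [IsNoetherianRing R] {r : ℕ} {x : Fin r → R}
    (hx : IsSeqInDimGT R N k x) {p : Ideal R} [p.IsPrime] (hp : zdim k < ringKrullDim (R ⧸ p)) :
    IsWeaklyRegular (LocalizedModule p.primeCompl N) (List.ofFn x) := by
  refine ⟨fun i hi ↦ ?_⟩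
  rw [ofList_take_ofFn, List.getElem_ofFn]
  refine isSMulRegular_localizedModule_quotient fun q hq hqp ↦ hx ⟨i, by simpa using hi⟩ q hq ?_
  exact hp.trans_le (ringKrullDim_le_of_surjective _ (Ideal.Quotient.factor_surjective hqp))

/-- If an ideal contained in a prime `p` with `dim (R / p) > k` contains an `N`-sequence in
dimension `> k` longer than `x`, then `p` is not associated to `N / (x) N`. -/
theorem IsSeqInDimGT.notMem_associatedPrimes [IsNoetherianRing R] {j r : ℕ} (hjr : j < r)
    {x : Fin j → R} {y : Fin r → R} (hx : IsSeqInDimGT R N k x) (hy : IsSeqInDimGT R N k y)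
    {p : Ideal R} (hp : zdim k < ringKrullDim (R ⧸ p)) (hyp : ∀ i, y i ∈ p) :
    p ∉ associatedPrimes R (N ⧸ (prefIdeal x j • ⊤ : Submodule R N)) := by
  intro hass
  obtain ⟨hprime, u, hu⟩ := mem_associatedPrimes_quotient_iff.mp hass
  let L := LocalizedModule p.primeCompl N
  have hext := subsingleton_ext_of_isWeaklyRegular (ModuleCat.of R (R ⧸ p)) (ModuleCat.of R L)
    (List.ofFn y) (by simpa [Ideal.annihilator_quotient] using hyp)
    (hy.isWeaklyRegular_localizedModule hp)
  have hsub := subsingleton_linearMap_of_subsingleton_ext (ModuleCat.of R (R ⧸ p))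
    (ModuleCat.of R L) (List.ofFn x) (hx.isWeaklyRegular_localizedModule hp)
    fun i hi ↦ hext i (lt_of_le_of_lt hi (by simpa using hjr))
  let K : Submodule R L := Ideal.ofList (List.ofFn x) • ⊤
  have hK : ∀ v, LocalizedModule.mkLinearMap p.primeCompl N v ∈ K ↔
      ∃ t ∉ p, t • v ∈ (prefIdeal x j • ⊤ : Submodule R N) := fun v ↦ by
    rw [← mkLinearMap_mem_smul_top_iff, ← ofList_ofFn]
  let w : L := LocalizedModule.mkLinearMap p.primeCompl N u
  let f : (R ⧸ p) →ₗ[R] (L ⧸ K) := Submodule.liftQ p (LinearMap.toSpanSingleton R _ (K.mkQ w))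
    fun a ha ↦ by
      rw [LinearMap.mem_ker, LinearMap.toSpanSingleton_apply, ← map_smul, ← LinearMap.mem_ker,
        Submodule.ker_mkQ, ← map_smul, hK]
      rw [hu, Submodule.mem_colon_singleton] at ha
      exact ⟨1, hprime.one_notMem, by rwa [one_smul]⟩
  have hf : f (Submodule.mkQ p 1) = 0 := by
    rw [show f = 0 from hsub.elim f 0, LinearMap.zero_apply]
  have hw : K.mkQ w = 0 := by
    rw [← hf]
    exact (one_smul R _).symm
  rw [← LinearMap.mem_ker, Submodule.ker_mkQ, hK] at hw
  obtain ⟨t, ht, htu⟩ := hw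
  exact ht (hu ▸ Submodule.mem_colon_singleton.mpr htu)

/-- If `x` is an `N`-sequence in dimension `> k` and `z` avoids the relevant associated primes of
`N / (x) N`, then appending `z` to `x` gives an `N`-sequence in dimension `> k`. -/
theorem IsSeqInDimGT.snoc {r : ℕ} {x : Fin r → R} (hx : IsSeqInDimGT R N k x) {z : R}
    (hz : ∀ p ∈ associatedPrimes R (N ⧸ (prefIdeal x r • ⊤ : Submodule R N)),
      zdim k < ringKrullDim (R ⧸ p) → z ∉ p) :
    IsSeqInDimGT R N k (Fin.snoc x z : Fin (r + 1) → R) := by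
  refine Fin.lastCases ?_ fun i ↦ ?_
  · rw [Fin.val_last, prefIdeal_snoc x z le_rfl, Fin.snoc_last]
    exact hz
  · rw [Fin.val_castSucc, prefIdeal_snoc x z i.2.le, Fin.snoc_castSucc]
    exact hx i

/-- An `N`-sequence in dimension `> k` in `I` longer than `j` exists if `j < depth_k (I, N)`. -/
theorem exists_isSeqInDimGT_of_lt_depthK {I : Ideal R} {j : ℕ}
    (h : (j : ℕ∞) < depthK R k I N) :
    ∃ r, j < r ∧ ∃ y : Fin r → R, (∀ i, y i ∈ I) ∧ IsSeqInDimGT R N k y := by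
  obtain ⟨_, ⟨r, y, hyI, hy, rfl⟩, hjr⟩ := lt_sSup_iff.mp h
  exact ⟨r, Nat.cast_lt.mp hjr, y, hyI, hy⟩

end DimensionSequence

/-- An ideal contains an element avoiding all members of a finite set of primes that do not contain
the ideal. -/
theorem Ideal.exists_mem_forall_notMem_of_finite {R : Type*} [CommRing R] (I : Ideal R)
    {s : Set (Ideal R)} (hs : s.Finite) (hprime : ∀ p ∈ s, p.IsPrime) :
    ∃ z ∈ I, ∀ p ∈ s, ¬ I ≤ p → z ∉ p := by
  have hfin : {p ∈ s | ¬ I ≤ p}.Finite := hs.subset (Set.sep_subset _ _)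
  by_contra! h
  have hcover : (I : Set R) ⊆ ⋃ p ∈ {p ∈ s | ¬ I ≤ p}, (p : Set R) := fun z hz ↦ by
    obtain ⟨p, hps, hp, hzp⟩ := h z hz
    exact Set.mem_biUnion (show p ∈ {p ∈ s | ¬ I ≤ p} from ⟨hps, hp⟩) hzp
  obtain ⟨p, hp, hIp⟩ := (Ideal.subset_union_prime_finite hfin ⊥ ⊥
    fun p hp _ _ ↦ hprime p hp.1).mp hcover
  exact hp.2 hIp

/-- Lemma: if `r ≥ 1` is the eventual value of `depth_k(I, N_n)` for the components `N_n = ℳ n`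
of a finitely generated graded module over a finitely generated standard graded `R`-algebra,
then there is a sequence `x₁,…,x_r` in `I` which is an `N_n`-sequence in dimension `> k`
simultaneously for all large `n`. -/
theorem exists_simultaneous_seq (R : Type) [CommRing R] [IsNoetherianRing R] [IsLocalRing R]
    (I : Ideal R)
    (S : Type) [CommRing S] [Algebra R S] [Algebra.FiniteType R S]
    (𝒜 : ℕ → Submodule R S) [GradedAlgebra 𝒜]
    (hstd : Algebra.adjoin R (𝒜 1 : Set S) = ⊤)
    (h0 : 𝒜 0 = Subalgebra.toSubmodule (⊥ : Subalgebra R S))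
    (M : Type) [AddCommGroup M] [Module R M] [Module S M] [IsScalarTower R S M]
    (ℳ : ℕ → Submodule R M) [SetLike.GradedSMul 𝒜 ℳ] [DirectSum.Decomposition ℳ]
    [Module.Finite S M]
    (k : ℤ) (hk : -1 ≤ k) (r : ℕ) (hr1 : 1 ≤ r)
    (hev : ∃ n₀ : ℕ, ∀ n ≥ n₀, depthK R k I (ℳ n) = (r : ℕ∞)) :
    ∃ x : Fin r → R, (∀ i, x i ∈ I) ∧
      ∃ n₁ : ℕ, ∀ n ≥ n₁, IsSeqInDimGT R (ℳ n) k x := by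
  have := Algebra.FiniteType.isNoetherianRing R S
  obtain ⟨n₀, hn₀⟩ := hev
  suffices h : ∀ j ≤ r, ∃ x : Fin j → R, (∀ i, x i ∈ I) ∧
      ∃ n₁ : ℕ, ∀ n ≥ n₁, IsSeqInDimGT R (ℳ n) k x from h r le_rfl
  intro j
  induction j with
  | zero => exact fun _ ↦ ⟨Fin.elim0, fun i ↦ i.elim0, 0, fun n _ i ↦ i.elim0⟩
  | succ j ih =>
    intro hj
    obtain ⟨x, hxI, n₁, hx⟩ := ih (by omega)
    obtain ⟨z, hzI, hz⟩ := I.exists_mem_forall_notMem_of_finite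
      (finite_associatedPrimes_quotient_smul_top (S := S) (M := M) (prefIdeal x j))
      fun p hp ↦ hp.isPrime
    refine ⟨Fin.snoc x z, Fin.lastCases (by simpa using hzI) (by simpa using hxI), max n₀ n₁,
      fun n hn ↦ (hx n (le_of_max_le_right hn)).snoc fun p hp hdim ↦ hz p ?_ fun hIp ↦ ?_⟩
    · refine associatedPrimes_quotient_smul_top_subset (ℳ n).subtype
        (DirectSum.component R ℕ (fun i ↦ ℳ i) n ∘ₗ
          (DirectSum.decomposeLinearEquiv ℳ).toLinearMap) (fun v ↦ ?_) _ hp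
      simp [DirectSum.component.lof_self]
    · obtain ⟨l, hjl, y, hyI, hy⟩ := exists_isSeqInDimGT_of_lt_depthK
        (N := ℳ n) (k := k) (I := I) (j := j)
        (by rw [hn₀ n (le_of_max_le_left hn)]; exact_mod_cast hj)
      exact (hx n (le_of_max_le_right hn)).notMem_associatedPrimes hjl hy hdim
        (fun i ↦ hIp (hyI i)) hp
end
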